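/- arXiv:1806.02055 — 3 statements merged into one kernel-verified Lean document; each statement's English description precedes it below -/
import Mathlib

section
/- Let c > 0 and define v_ind(v) = √((−v² + √(v⁴ + c²))/2) for v ≥ 0. Then v · v_ind(v) → c/2 as v → ∞; in particular v_ind(v) → 0 as v → ∞, so the induced power m·g·v_ind(v) tends to 0 at high airspeed and is asymptotically inversely proportional to the airspeed v. -/
open Real Filter

/-- Rationalized form of `v · v_ind v`. -/
theorem mul_sqrt_neg_sq_add_sqrt_div_two {v : ℝ} (hv : 0 < v) (c : ℝ) :
    v * √((-v ^ 2 + √(v ^ 4 + c ^ 2)) / 2)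
      = √(c ^ 2 / 2 / (1 + √(1 + c ^ 2 / v ^ 4))) := by
  have hsqrt : √(v ^ 4 + c ^ 2) = v ^ 2 * √(1 + c ^ 2 / v ^ 4) := by
    rw [← Real.sqrt_sq (sq_nonneg v), ← Real.sqrt_mul (sq_nonneg _)]
    congr 1
    field_simp
  have hsq : √(1 + c ^ 2 / v ^ 4) ^ 2 = 1 + c ^ 2 / v ^ 4 := Real.sq_sqrt (by positivity)
  have hpos : 0 < 1 + √(1 + c ^ 2 / v ^ 4) := by positivity
  rw [hsqrt]
  nth_rewrite 1 [← Real.sqrt_sq hv.le]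
  rw [← Real.sqrt_mul (sq_nonneg v)]
  congr 1
  rw [eq_div_iff hpos.ne']
  calc v ^ 2 * ((-v ^ 2 + v ^ 2 * √(1 + c ^ 2 / v ^ 4)) / 2) * (1 + √(1 + c ^ 2 / v ^ 4))
      = v ^ 4 * (√(1 + c ^ 2 / v ^ 4) ^ 2 - 1) / 2 := by ring
    _ = c ^ 2 / 2 := by
      rw [hsq]
      field_simp
      ring

theorem tendsto_mul_sqrt_neg_sq_add_sqrt_div_two {c : ℝ} (hc : 0 ≤ c) :
    Tendsto (fun v : ℝ => v * √((-v ^ 2 + √(v ^ 4 + c ^ 2)) / 2)) atTop (nhds (c / 2)) := by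
  have hquot : Tendsto (fun v : ℝ => c ^ 2 / v ^ 4) atTop (nhds 0) :=
    tendsto_const_nhds.div_atTop (tendsto_pow_atTop (by norm_num))
  have hlim := (tendsto_const_nhds (x := c ^ 2 / 2)).div
    ((hquot.const_add 1).sqrt.const_add 1) (by positivity) |>.sqrt
  have hval : √(c ^ 2 / 2 / (1 + √(1 + 0))) = c / 2 := by
    rw [add_zero, Real.sqrt_one, show c ^ 2 / 2 / (1 + 1) = (c / 2) ^ 2 by ring]
    exact Real.sqrt_sq (by positivity)
  rw [hval] at hlim
  refine hlim.congr' ?_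
  filter_upwards [eventually_gt_atTop 0] with v hv
  exact (mul_sqrt_neg_sq_add_sqrt_div_two hv c).symm

/-- High-speed asymptotics of the induced velocity
`v_ind v = √((-v² + √(v⁴ + c²))/2)`: `v · v_ind v → c/2` as `v → ∞`; in
particular `v_ind v → 0`, so the induced power `m·g·v_ind v` tends to `0` at
high airspeed and is asymptotically inversely proportional to the airspeed. -/
theorem induced_velocity_asymptotics
    (c m g : ℝ) (hc : 0 < c) (hm : 0 < m) (hg : 0 < g)
    (vind : ℝ → ℝ)
    (hvind : ∀ v, vind v
      = Real.sqrt ((-v ^ 2 + Real.sqrt (v ^ 4 + c ^ 2)) / 2)) :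
    Tendsto (fun v => v * vind v) atTop (nhds (c / 2)) ∧
    Tendsto vind atTop (nhds 0) ∧
    Tendsto (fun v => m * g * vind v) atTop (nhds 0) := by
  have hmul : Tendsto (fun v => v * vind v) atTop (nhds (c / 2)) := by
    simpa only [hvind] using tendsto_mul_sqrt_neg_sq_add_sqrt_div_two hc.le
  have hzero : Tendsto vind atTop (nhds 0) := by
    refine (hmul.div_atTop tendsto_id).congr' ?_
    filter_upwards [eventually_ne_atTop 0] with v hv
    exact mul_div_cancel_left₀ _ hv
  exact ⟨hmul, hzero, by simpa using hzero.const_mul (m * g)⟩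
end

section
/- Let m, g, ρ, A_d, k_o, C_ds, v_t be positive real constants, set c = mg/(ρA_d), and define P_ff(v) = m·g·v_ind(v) + (1/2)·ρ·v³·C_ds + k_o·(1 + 3·v²/v_t²) with v_ind(v) = √((−v² + √(v⁴ + c²))/2) for v ≥ 0. If 3·k_o/v_t² < m·g/(2·√(2c)), then there exists v > 0 such that P_ff(v) < P_ff(0); that is, hovering consumes strictly more power than forward flight at some positive airspeed. -/
open Real

/-- Second-order upper bound, at `v = 0`, for the induced velocity. -/
lemma sqrt_induced_le {c : ℝ} (hc : 0 < c) (v : ℝ) :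
    √((-v ^ 2 + √(v ^ 4 + c ^ 2)) / 2)
      ≤ √(2 * c) / 2 + (-v ^ 2 + v ^ 4 / (2 * c)) / (2 * √(2 * c)) := by
  have hs : 0 < √(2 * c) := by positivity
  have hsq : √(2 * c) ^ 2 = 2 * c := sq_sqrt (by positivity)
  have hin : √(v ^ 4 + c ^ 2) ≤ c + v ^ 4 / (2 * c) := by
    refine sqrt_le_iff.mpr ⟨by positivity, ?_⟩
    have : (c + v ^ 4 / (2 * c)) ^ 2 = c ^ 2 + v ^ 4 + (v ^ 4 / (2 * c)) ^ 2 := by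
      field_simp
      ring
    nlinarith [sq_nonneg (v ^ 4 / (2 * c))]
  set d := -v ^ 2 + v ^ 4 / (2 * c) with hd
  have hdc : 0 ≤ 2 * c + d := by
    have : 2 * c + d = ((v ^ 2 - c) ^ 2 + 3 * c ^ 2) / (2 * c) := by
      rw [hd]
      field_simp
      ring
    rw [this]
    positivity
  have hrhs : √(2 * c) / 2 + d / (2 * √(2 * c)) = (2 * c + d) / (2 * √(2 * c)) := by
    field_simp
    rw [hsq]
  refine sqrt_le_iff.mpr ⟨by rw [hrhs]; positivity, ?_⟩
  have hexp : (√(2 * c) / 2 + d / (2 * √(2 * c))) ^ 2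
      = √(2 * c) ^ 2 / 4 + d / 2 + (d / (2 * √(2 * c))) ^ 2 := by
    field_simp
    ring
  rw [hexp, hsq]
  linarith [sq_nonneg (d / (2 * √(2 * c)))]

/-- If the blade-profile coefficient is small enough, namely
`3·k_o/v_t² < m·g/(2·√(2c))` with `c = mg/(ρA_d)`, then hovering consumes
strictly more power than forward flight at some positive airspeed:
there is `v > 0` with `P_ff v < P_ff 0`. -/
theorem hover_power_not_optimal
    (m g ρ Ad ko Cds vt c : ℝ)
    (hm : 0 < m) (hg : 0 < g) (hρ : 0 < ρ) (hAd : 0 < Ad)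
    (hko : 0 < ko) (hCds : 0 < Cds) (hvt : 0 < vt)
    (hc : c = m * g / (ρ * Ad))
    (vind : ℝ → ℝ)
    (hvind : ∀ v, vind v
      = Real.sqrt ((-v ^ 2 + Real.sqrt (v ^ 4 + c ^ 2)) / 2))
    (Pff : ℝ → ℝ)
    (hPff : ∀ v, Pff v
      = m * g * vind v + (1 / 2) * ρ * v ^ 3 * Cds + ko * (1 + 3 * v ^ 2 / vt ^ 2))
    (hsmall : 3 * ko / vt ^ 2 < m * g / (2 * Real.sqrt (2 * c))) :
    ∃ v : ℝ, 0 < v ∧ Pff v < Pff 0 := by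
  have hcpos : 0 < c := by rw [hc]; positivity
  have hs : 0 < √(2 * c) := by positivity
  have hzero : vind 0 = √(2 * c) / 2 := by
    rw [hvind, sqrt_eq_iff_mul_self_eq (by positivity) (by positivity)]
    have h1 : √((0 : ℝ) ^ 4 + c ^ 2) = c := by
      rw [zero_pow (by norm_num), zero_add, sqrt_sq hcpos.le]
    rw [h1]
    linarith [sq_sqrt (show 0 ≤ 2 * c by positivity)]
  set a := m * g / (2 * √(2 * c)) with ha
  set b := 3 * ko / vt ^ 2 with hb
  have hapos : 0 < a := by positivity
  set K := a / (2 * c) + ρ * Cds / 2 with hK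
  have hKpos : 0 < K := by positivity
  have hε : 0 < a - b := sub_pos.mpr hsmall
  obtain ⟨v, hv0, hv⟩ := exists_between (show 0 < min 1 ((a - b) / K) by positivity)
  have hv1 : v < 1 := hv.trans_le (min_le_left _ _)
  have hvK : v * K < a - b := (lt_div_iff₀ hKpos).mp (hv.trans_le (min_le_right _ _))
  refine ⟨v, hv0, ?_⟩
  have hind : m * g * vind v
      ≤ m * g * (√(2 * c) / 2) + a * (-v ^ 2 + v ^ 4 / (2 * c)) := by
    have h := mul_le_mul_of_nonneg_left (sqrt_induced_le hcpos v) (mul_pos hm hg).le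
    rw [hvind]
    refine h.trans_eq ?_
    rw [ha]
    ring
  have hneg : a / (2 * c) * v ^ 2 + ρ * Cds / 2 * v + b - a < 0 := by
    have h : a / (2 * c) * v ^ 2 ≤ a / (2 * c) * v :=
      mul_le_mul_of_nonneg_left (by nlinarith) (by positivity)
    rw [hK] at hvK
    linarith
  have hprod := mul_neg_of_pos_of_neg (pow_pos hv0 2) hneg
  have hprofile : ko * (1 + 3 * v ^ 2 / vt ^ 2) = ko + b * v ^ 2 := by
    rw [hb]
    ring
  have hquartic : a * (v ^ 4 / (2 * c)) = v ^ 2 * (a / (2 * c) * v ^ 2) := by ring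
  have hhover : Pff 0 = m * g * (√(2 * c) / 2) + ko := by
    rw [hPff, hzero]
    ring
  rw [hPff v, hhover, hprofile]
  linarith only [hind, hprod, hquartic]
end

section
/- Let r > 0, a > 0 and b > 0, and define for altitude h ≥ 0 the line-of-sight Cramér–Rao ranging bound at fixed horizontal (ground) distance r: F(h) = (ln(10)/20) · a · √(h² + r²) · exp(−b·arctan(h/r)), where d = √(h² + r²) is the anchor–node distance and θ = arctan(h/r) the elevation angle. Then F is strictly decreasing on [0, b·r] and strictly increasing on [b·r, ∞); hence F attains its unique global minimum at the altitude h* = b·r, i.e., at the optimal elevation angle θ* = arctan(b), with minimum value (ln(10)/20) · a · r·√(1 + b²) · exp(−b·arctan(b)). -/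
open Real

theorem hasDerivAt_sqrt_mul_exp_arctan {r : ℝ} (hr : 0 < r) (c b h : ℝ) :
    HasDerivAt (fun x => c * √(x ^ 2 + r ^ 2) * exp (-b * arctan (x / r)))
      (c * exp (-b * arctan (h / r)) / √(h ^ 2 + r ^ 2) * (h - b * r)) h := by
  have hpos : 0 < h ^ 2 + r ^ 2 := by positivity
  have h_sqrt : HasDerivAt (fun x : ℝ => √(x ^ 2 + r ^ 2)) (h / √(h ^ 2 + r ^ 2)) h := by
    refine (((hasDerivAt_pow 2 h).add_const (r ^ 2)).sqrt hpos.ne').congr_deriv ?_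
    push_cast
    field_simp
  have h_exp : HasDerivAt (fun x : ℝ => exp (-b * arctan (x / r)))
      (exp (-b * arctan (h / r)) * (-b * (r / (h ^ 2 + r ^ 2)))) h := by
    refine ((((hasDerivAt_id' h).div_const r).arctan).const_mul (-b)).exp.congr_deriv ?_
    field_simp
    ring
  refine ((h_sqrt.const_mul c).mul h_exp).congr_deriv ?_
  have hs : √(h ^ 2 + r ^ 2) ≠ 0 := (sqrt_pos.mpr hpos).ne'
  have hsq : h ^ 2 + r ^ 2 = √(h ^ 2 + r ^ 2) ^ 2 := (sq_sqrt hpos.le).symm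
  generalize √(h ^ 2 + r ^ 2) = s at *
  rw [hsq]
  field_simp
  ring

/-- Optimal altitude for RSS ranging: the line-of-sight Cramér–Rao ranging
bound at fixed horizontal distance `r > 0`,
`F h = (ln 10 / 20) · a · √(h² + r²) · exp (-b·arctan (h/r))`, is strictly
decreasing on `[0, b·r]` and strictly increasing on `[b·r, ∞)`; hence it
attains its unique global minimum at the altitude `h* = b·r` (elevation angle
`arctan b`), with minimum value
`(ln 10 / 20) · a · r·√(1 + b²) · exp (-b·arctan b)`. -/
theorem crlb_optimal_altitude
    (r a b : ℝ) (hr : 0 < r) (ha : 0 < a) (hb : 0 < b)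
    (F : ℝ → ℝ)
    (hF : ∀ h, F h = (Real.log 10 / 20) * a * Real.sqrt (h ^ 2 + r ^ 2) *
      Real.exp (-b * Real.arctan (h / r))) :
    StrictAntiOn F (Set.Icc 0 (b * r)) ∧
    StrictMonoOn F (Set.Ici (b * r)) ∧
    (∀ h : ℝ, 0 ≤ h → h ≠ b * r → F (b * r) < F h) ∧
    F (b * r) = (Real.log 10 / 20) * a * (r * Real.sqrt (1 + b ^ 2)) *
      Real.exp (-b * Real.arctan b) := by
  obtain rfl : F = fun h => (Real.log 10 / 20) * a * √(h ^ 2 + r ^ 2) *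
      exp (-b * arctan (h / r)) := funext hF
  have hc : 0 < Real.log 10 / 20 * a := by
    have : 0 < Real.log 10 := Real.log_pos (by norm_num)
    positivity
  have hd := hasDerivAt_sqrt_mul_exp_arctan hr (Real.log 10 / 20 * a) b
  have hfac (x : ℝ) : 0 < Real.log 10 / 20 * a * exp (-b * arctan (x / r)) /
      √(x ^ 2 + r ^ 2) := by positivity
  have h_anti := strictAntiOn_of_deriv_neg (convex_Icc 0 (b * r))
    (fun x _ => (hd x).continuousAt.continuousWithinAt) fun x hx => by
      rw [interior_Icc] at hx
      rw [(hd x).deriv]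
      exact mul_neg_of_pos_of_neg (hfac x) (sub_neg.mpr hx.2)
  have h_mono := strictMonoOn_of_deriv_pos (convex_Ici (b * r))
    (fun x _ => (hd x).continuousAt.continuousWithinAt) fun x hx => by
      rw [interior_Ici] at hx
      rw [(hd x).deriv]
      exact mul_pos (hfac x) (sub_pos.mpr hx)
  refine ⟨h_anti, h_mono, fun h h0 hne => ?_, ?_⟩
  · rcases hne.lt_or_gt with hlt | hgt
    · exact h_anti ⟨h0, hlt.le⟩ ⟨by positivity, le_rfl⟩ hlt
    · exact h_mono Set.self_mem_Ici hgt.le hgt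
  · have hsqrt : √((b * r) ^ 2 + r ^ 2) = r * √(1 + b ^ 2) := by
      rw [show (b * r) ^ 2 + r ^ 2 = r ^ 2 * (1 + b ^ 2) by ring,
        sqrt_mul (sq_nonneg r), sqrt_sq hr.le]
    simp only [hsqrt, mul_div_cancel_right₀ b hr.ne']
end
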